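/- Let M = (W,≼,S,⟦·⟧) be a dynamic poset model, w ∈ W, and φ a formula. Then the following are equivalent: (a) w ∈ ⟦□φ⟧; (b) w belongs to the interior (with respect to the up-set topology of ≼) of ⋂_{n<ω} S⁻ⁿ⟦φ⟧; (c) for all n < ω, Sⁿ(w) ∈ ⟦φ⟧. -/

import Mathlib

/-- Formulas of the language `L` of intuitionistic linear temporal logic. -/
inductive Formula : Type
  | bot : Formula
  | var : ℕ → Formula
  | and : Formula → Formula → Formula
  | or : Formula → Formula → Formula
  | impl : Formula → Formula → Formula
  | next : Formula → Formula
  | diam : Formula → Formula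
  | box : Formula → Formula
deriving DecidableEq

namespace Formula

/-- `¬φ` abbreviates `φ → ⊥`. -/
def neg (φ : Formula) : Formula := impl φ bot

/-- `φ ↔ ψ` abbreviates `(φ → ψ) ∧ (ψ → φ)`. -/
def iff (φ ψ : Formula) : Formula := and (impl φ ψ) (impl ψ φ)

end Formula

/-- Derivability in `ITL⁰` extended with an additional set of axioms `Ax`.
The intuitionistic propositional tautologies are generated by a standard
complete Hilbert-style axiomatization of intuitionistic propositional logic
(closed under modus ponens). -/
inductive ITL (Ax : Formula → Prop) : Formula → Prop
  | extra {φ} : Ax φ → ITL Ax φ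
  -- (i) intuitionistic propositional axioms
  | then1 (φ ψ : Formula) : ITL Ax (.impl φ (.impl ψ φ))
  | then2 (φ ψ χ : Formula) :
      ITL Ax (.impl (.impl φ (.impl ψ χ)) (.impl (.impl φ ψ) (.impl φ χ)))
  | andE1 (φ ψ : Formula) : ITL Ax (.impl (.and φ ψ) φ)
  | andE2 (φ ψ : Formula) : ITL Ax (.impl (.and φ ψ) ψ)
  | andI (φ ψ : Formula) : ITL Ax (.impl φ (.impl ψ (.and φ ψ)))
  | orI1 (φ ψ : Formula) : ITL Ax (.impl φ (.or φ ψ))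
  | orI2 (φ ψ : Formula) : ITL Ax (.impl ψ (.or φ ψ))
  | orE (φ ψ χ : Formula) :
      ITL Ax (.impl (.impl φ χ) (.impl (.impl ψ χ) (.impl (.or φ ψ) χ)))
  | botE (φ : Formula) : ITL Ax (.impl .bot φ)
  -- (ii)–(x) temporal axioms
  | nextBot : ITL Ax (.neg (.next .bot))
  | nextAnd (φ ψ : Formula) :
      ITL Ax (.iff (.next (.and φ ψ)) (.and (.next φ) (.next ψ)))
  | nextOr (φ ψ : Formula) :
      ITL Ax (.iff (.next (.or φ ψ)) (.or (.next φ) (.next ψ)))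
  | nextK (φ ψ : Formula) :
      ITL Ax (.impl (.next (.impl φ ψ)) (.impl (.next φ) (.next ψ)))
  | boxK (φ ψ : Formula) :
      ITL Ax (.impl (.box (.impl φ ψ)) (.impl (.box φ) (.box ψ)))
  | diamK (φ ψ : Formula) :
      ITL Ax (.impl (.box (.impl φ ψ)) (.impl (.diam φ) (.diam ψ)))
  | diamOr (φ ψ : Formula) :
      ITL Ax (.impl (.diam (.or φ ψ)) (.or (.diam φ) (.diam ψ)))
  | boxFix (φ : Formula) : ITL Ax (.impl (.box φ) (.and φ (.next (.box φ))))
  | diamFix (φ : Formula) : ITL Ax (.impl (.or φ (.next (.diam φ))) (.diam φ))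
  -- rules (xi)–(xiv)
  | ind1 {φ : Formula} : ITL Ax (.impl φ (.next φ)) → ITL Ax (.impl φ (.box φ))
  | ind2 {φ : Formula} : ITL Ax (.impl (.next φ) φ) → ITL Ax (.impl (.diam φ) φ)
  | mp {φ ψ : Formula} : ITL Ax (.impl φ ψ) → ITL Ax φ → ITL Ax ψ
  | nec {φ : Formula} : ITL Ax φ → ITL Ax (.next φ)

/-- The Fischer Servi axiom schemes FS◦ and FS◇. -/
def FSAx : Formula → Prop := fun χ => ∃ φ ψ : Formula,
  χ = .impl (.impl (.next φ) (.next ψ)) (.next (.impl φ ψ)) ∨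
  χ = .impl (.impl (.diam φ) (.box ψ)) (.box (.impl φ ψ))

/-- The constant domain axiom scheme CD. -/
def CDAx : Formula → Prop := fun χ => ∃ φ ψ : Formula,
  χ = .impl (.box (.or φ ψ)) (.or (.box φ) (.diam ψ))

/-- The logic ITL⁰. -/
def ITL0 : Formula → Prop := ITL (fun _ => False)

/-- The logic ITL^FS = ITL⁰ + FS◦ + FS◇. -/
def ITLFS : Formula → Prop := ITL FSAx

/-- The logic ITL^CD = ITL⁰ + CD. -/
def ITLCD : Formula → Prop := ITL CDAx

/-- The logic ITL¹ = ITL^FS + ITL^CD. -/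
def ITL1 : Formula → Prop := ITL (fun χ => FSAx χ ∨ CDAx χ)

/-- A valuation on a dynamical topological system `(X, T, S)`: a map from
formulas to open sets satisfying the semantic clauses. -/
structure DTValuation (X : Type) (T : TopologicalSpace X) (S : X → X) where
  val : Formula → Set X
  isOpen_val : ∀ φ, @IsOpen X T (val φ)
  val_bot : val .bot = ∅
  val_and : ∀ φ ψ, val (.and φ ψ) = val φ ∩ val ψ
  val_or : ∀ φ ψ, val (.or φ ψ) = val φ ∪ val ψ
  val_impl : ∀ φ ψ, val (.impl φ ψ) = @interior X T ((val φ)ᶜ ∪ val ψ)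
  val_next : ∀ φ, val (.next φ) = S ⁻¹' val φ
  val_diam : ∀ φ, val (.diam φ) = ⋃ n : ℕ, (S^[n]) ⁻¹' val φ
  val_box : ∀ φ, val (.box φ) =
    ⋃₀ {U : Set X | @IsOpen X T U ∧ S '' U ⊆ U ∧ U ⊆ val φ}

/-- The up-set topology of a preorder: the open sets are the upward closed sets. -/
def upsetTopology (X : Type) [Preorder X] : TopologicalSpace X where
  IsOpen U := IsUpperSet U
  isOpen_univ := isUpperSet_univ
  isOpen_inter := fun _ _ hU hV => hU.inter hV
  isOpen_sUnion := fun _ hs => isUpperSet_sUnion hs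

/-- In the up-set topology the intersection of all iterated preimages of an open set is open. -/
theorem isOpen_iInter_iterate_preimage {W : Type} [Preorder W] {S : W → W}
    (hS : @Continuous W W (upsetTopology W) (upsetTopology W) S) {U : Set W}
    (hU : @IsOpen W (upsetTopology W) U) :
    @IsOpen W (upsetTopology W) (⋂ n : ℕ, (S^[n]) ⁻¹' U) := by
  let _ := upsetTopology W
  have hpre (n : ℕ) : IsUpperSet ((S^[n]) ⁻¹' U) := hU.preimage (hS.iterate n)
  exact isUpperSet_iInter hpre

/-- Lemma 3: the three characterizations of `henceforth` on dynamic posets. -/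
theorem box_mem_tfae (W : Type) [PartialOrder W] (S : W → W)
    (hS : @Continuous W W (upsetTopology W) (upsetTopology W) S)
    (V : DTValuation W (upsetTopology W) S) (w : W) (φ : Formula) :
    (w ∈ V.val (.box φ) ↔
      w ∈ @interior W (upsetTopology W) (⋂ n : ℕ, (S^[n]) ⁻¹' V.val φ)) ∧
    (w ∈ V.val (.box φ) ↔ ∀ n : ℕ, S^[n] w ∈ V.val φ) := by
  let _ := upsetTopology W
  have hopen := isOpen_iInter_iterate_preimage hS (V.isOpen_val φ)
  have hbox : V.val (.box φ) = ⋂ n : ℕ, (S^[n]) ⁻¹' V.val φ := by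
    rw [V.val_box]
    apply Set.Subset.antisymm
    · rintro x ⟨U, ⟨-, hSU, hUφ⟩, hx⟩
      have hmaps : Set.MapsTo S U U := Set.mapsTo_iff_image_subset.mpr hSU
      exact Set.mem_iInter.mpr fun n => hUφ (hmaps.iterate n hx)
    · refine Set.subset_sUnion_of_mem ⟨hopen, ?_, Set.iInter_subset _ 0⟩
      rintro _ ⟨x, hx, rfl⟩
      exact Set.mem_iInter.mpr fun n => Set.mem_iInter.mp hx (n + 1)
  rw [hopen.interior_eq, hbox]
  exact ⟨Iff.rfl, Set.mem_iInter⟩
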